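/- Let (E, 𝓛, 𝓑) be a weakly left-resolving labeled space, let {p_A : A ∈ 𝓑}, {s_a : a ∈ 𝒜} be a representation of (E, 𝓛, 𝓑) in a C*-algebra, and let A ∈ 𝓑 be a minimal sinks set. Set 𝓛*(A) := {α ∈ 𝓛*(E) : r(α) ⊇ A} ∪ {ε}. Then the elements e_{α,β} := s_α p_A s_β* for α, β ∈ 𝓛*(A) form a system of matrix units: e_{α,β} e_{μ,ν} = δ_{β,μ} e_{α,ν} for all α, β, μ, ν ∈ 𝓛*(A), and e_{α,β}* = e_{β,α}. -/

import Mathlib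

universe u v w

/-- A labeled graph: a directed graph with source and range maps together with a
labeling of the edges by an alphabet `Λ` (onto, i.e. `Λ = 𝓛(E¹)`). -/
structure LabeledGraph (V : Type u) (E : Type v) (Λ : Type w) where
  src : E → V
  rng : E → V
  lab : E → Λ
  lab_surj : Function.Surjective lab

namespace LabeledGraph

variable {V : Type u} {E : Type v} {Λ : Type w} (G : LabeledGraph V E Λ)

/-- A (finite, nonempty) path: a nonempty list of composable edges. -/
def IsPath (p : List E) : Prop :=
  p ≠ [] ∧ p.Chain' (fun e f => G.rng e = G.src f)

/-- The relative range `r(A, α)`. -/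
def relRange (A : Set V) (α : List Λ) : Set V :=
  {v | ∃ p : List E, G.IsPath p ∧ p.map G.lab = α ∧
      (∃ e, p.head? = some e ∧ G.src e ∈ A) ∧
      (∃ e, p.getLast? = some e ∧ G.rng e = v)}

/-- The range `r(α) = r(E⁰, α)`. -/
def range (α : List Λ) : Set V := G.relRange Set.univ α

/-- The source set `s(α)` of a word. -/
def srcSet (α : List Λ) : Set V :=
  {v | ∃ p : List E, G.IsPath p ∧ p.map G.lab = α ∧
      (∃ e, p.head? = some e ∧ G.src e = v)}

/-- `𝓛(A E¹)`: the labels of edges with source in `A`. -/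
def labelSet (A : Set V) : Set Λ :=
  {a | ∃ e, G.src e ∈ A ∧ G.lab e = a}

/-- `𝓛*(E)`: the labels of finite nonempty paths. -/
def words : Set (List Λ) :=
  {α | ∃ p : List E, G.IsPath p ∧ p.map G.lab = α}

/-- `𝓛^#(E) = 𝓛*(E) ∪ {ε}`. -/
def wordsHash : Set (List Λ) := insert [] G.words

/-- The set of sinks `E⁰_sink`. -/
def sinks : Set V := {v | ∀ e : E, G.src e ≠ v}

/-- `ℬ ⊆ 2^{E⁰}` is accommodating. -/
structure Accommodating (ℬ : Set (Set V)) : Prop where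
  nonempty : ∃ A ∈ ℬ, A ≠ ∅
  range_mem : ∀ α ∈ G.words, G.range α ∈ ℬ
  relRange_mem : ∀ A ∈ ℬ, ∀ α ∈ G.words, G.relRange A α ∈ ℬ
  inter_mem : ∀ A ∈ ℬ, ∀ B ∈ ℬ, A ∩ B ∈ ℬ
  union_mem : ∀ A ∈ ℬ, ∀ B ∈ ℬ, A ∪ B ∈ ℬ

/-- `(E, 𝓛, ℬ)` is weakly left-resolving. -/
def WeaklyLeftResolving (ℬ : Set (Set V)) : Prop :=
  ∀ A ∈ ℬ, ∀ B ∈ ℬ, ∀ α ∈ G.words,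
    G.relRange (A ∩ B) α = G.relRange A α ∩ G.relRange B α

/-- `ℬ` is closed under relative complements (non-degeneracy). -/
def NonDegenerate (_G : LabeledGraph V E Λ) (ℬ : Set (Set V)) : Prop :=
  ∀ A ∈ ℬ, ∀ B ∈ ℬ, A \ B ∈ ℬ

/-- A hereditary subset `ℋ` of `ℬ` (not containing `∅`). -/
structure Hereditary (ℬ ℋ : Set (Set V)) : Prop where
  subset : ℋ ⊆ ℬ
  empty_not_mem : ∅ ∉ ℋ
  relRange_mem : ∀ A ∈ ℋ, ∀ α ∈ G.words, G.relRange A α ≠ ∅ → G.relRange A α ∈ ℋ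
  union_mem : ∀ A ∈ ℋ, ∀ B ∈ ℋ, A ∪ B ∈ ℋ
  mem_of_subset : ∀ A ∈ ℋ, ∀ B ∈ ℬ, B ≠ ∅ → B ⊆ A → B ∈ ℋ

/-- A minimal sinks set. -/
def MinimalSinksSet (ℬ : Set (Set V)) (A : Set V) : Prop :=
  A ∈ ℬ ∧ A.Nonempty ∧ A ⊆ G.sinks ∧ ∀ B ∈ ℬ, A ⊆ B ∨ A ∩ B = ∅

end LabeledGraph

/-- A representation of the labeled space `(E, 𝓛, ℬ)` in a C*-algebra `B`. -/
structure LabeledSpaceRep {V : Type u} {E : Type v} {Λ : Type w}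
    (G : LabeledGraph V E Λ) (ℬ : Set (Set V))
    (B : Type*) [CStarAlgebra B] where
  p : Set V → B
  s : Λ → B
  p_empty : p ∅ = 0
  p_selfAdjoint : ∀ A ∈ ℬ, star (p A) = p A
  s_partialIsometry : ∀ a : Λ, s a * star (s a) * s a = s a
  p_inter : ∀ A ∈ ℬ, ∀ A' ∈ ℬ, p A * p A' = p (A ∩ A')
  p_union : ∀ A ∈ ℬ, ∀ A' ∈ ℬ, p (A ∪ A') = p A + p A' - p (A ∩ A')
  s_star_s : ∀ a b : Λ, star (s a) * s b = open Classical in if a = b then p (G.range [a]) else 0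

  s_star_p : ∀ a : Λ, ∀ A ∈ ℬ, star (s a) * p A = p (G.relRange A [a]) * star (s a)
  p_sum : ∀ A ∈ ℬ, ∀ hfin : (G.labelSet A).Finite, A ∩ G.sinks = ∅ →
      p A = ∑ a ∈ hfin.toFinset, s a * p (G.relRange A [a]) * star (s a)

namespace LabeledSpaceRep

variable {V : Type u} {E : Type v} {Λ : Type w}
  {G : LabeledGraph V E Λ} {ℬ : Set (Set V)}
  {B : Type*} [CStarAlgebra B]

/-- `s_μ = s_{a₁} ⋯ s_{aₙ}` for a word `μ = a₁ ⋯ aₙ`; `s_ε = 1`. -/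
def sWord (ρ : LabeledSpaceRep G ℬ B) (μ : List Λ) : B := (μ.map ρ.s).prod

end LabeledSpaceRep

namespace LabeledGraph

variable {V : Type u} {E : Type v} {Λ : Type w} (G : LabeledGraph V E Λ)

theorem mem_relRange_singleton {A : Set V} {a : Λ} {v : V} :
    v ∈ G.relRange A [a] ↔ ∃ e, G.lab e = a ∧ G.src e ∈ A ∧ G.rng e = v := by
  constructor
  · rintro ⟨p, -, hl, ⟨e, he, hs⟩, ⟨f, hf, hr⟩⟩
    obtain ⟨x, rfl, hx⟩ := List.map_eq_singleton_iff.1 hl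
    simp only [List.head?_cons, List.getLast?_singleton, Option.some.injEq] at he hf
    subst he hf
    exact ⟨x, hx, hs, hr⟩
  · rintro ⟨e, rfl, hs, rfl⟩
    exact ⟨[e], ⟨by simp, List.isChain_singleton e⟩, rfl, ⟨e, rfl, hs⟩, ⟨e, rfl, rfl⟩⟩

theorem relRange_cons_cons (A : Set V) (a b : Λ) (w : List Λ) :
    G.relRange A (a :: b :: w) = G.relRange (G.relRange A [a]) (b :: w) := by
  ext v
  constructor
  · rintro ⟨p, ⟨-, hc⟩, hl, ⟨e, he, hs⟩, ⟨f, hf, hr⟩⟩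
    obtain ⟨x, q, rfl, hx, hq⟩ := List.map_eq_cons_iff.1 hl
    obtain ⟨y, q, rfl, hy, hq'⟩ := List.map_eq_cons_iff.1 hq
    simp only [List.head?_cons, Option.some.injEq] at he
    subst he
    obtain ⟨hxy, hc⟩ := List.isChain_cons_cons.1 hc
    exact ⟨y :: q, ⟨by simp, hc⟩, hq, ⟨y, rfl, G.mem_relRange_singleton.2 ⟨x, hx, hs, hxy⟩⟩,
      ⟨f, by simpa using hf, hr⟩⟩
  · rintro ⟨p, ⟨-, hc⟩, hl, ⟨e, he, hs⟩, ⟨f, hf, hr⟩⟩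
    obtain ⟨x, hx, hxs, hxe⟩ := G.mem_relRange_singleton.1 hs
    obtain ⟨y, q, rfl, hy, hq⟩ := List.map_eq_cons_iff.1 hl
    simp only [List.head?_cons, Option.some.injEq] at he
    subst he
    exact ⟨x :: y :: q, ⟨by simp, List.isChain_cons_cons.2 ⟨hxe, hc⟩⟩, by rw [List.map_cons, hx, hl],
      ⟨x, rfl, hxs⟩, ⟨f, by simpa using hf, hr⟩⟩

theorem singleton_mem_words (a : Λ) : [a] ∈ G.words := by
  obtain ⟨e, rfl⟩ := G.lab_surj a
  exact ⟨[e], ⟨by simp, List.isChain_singleton e⟩, rfl⟩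

theorem relRange_subset_range (A : Set V) (α : List Λ) : G.relRange A α ⊆ G.range α := by
  rintro v ⟨p, hp, hl, ⟨e, he, -⟩, hr⟩
  exact ⟨p, hp, hl, ⟨e, he, trivial⟩, hr⟩

theorem relRange_singleton_of_subset_sinks {A : Set V} (hA : A ⊆ G.sinks) (a : Λ) :
    G.relRange A [a] = ∅ := by
  refine Set.eq_empty_of_forall_notMem fun v hv => ?_
  obtain ⟨e, -, hs, -⟩ := G.mem_relRange_singleton.1 hv
  exact hA hs e rfl

end LabeledGraph

namespace LabeledSpaceRep

variable {V : Type u} {E : Type v} {Λ : Type w}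
  {G : LabeledGraph V E Λ} {ℬ : Set (Set V)}
  {B : Type*} [CStarAlgebra B] (ρ : LabeledSpaceRep G ℬ B)

@[simp]
theorem sWord_nil : ρ.sWord [] = 1 := by simp [sWord]

@[simp]
theorem sWord_cons (a : Λ) (w : List Λ) : ρ.sWord (a :: w) = ρ.s a * ρ.sWord w := by
  simp [sWord]

theorem star_s_mul_s_self (a : Λ) : star (ρ.s a) * ρ.s a = ρ.p (G.range [a]) := by
  simp [ρ.s_star_s]

theorem star_s_mul_s_of_ne {a b : Λ} (h : a ≠ b) : star (ρ.s a) * ρ.s b = 0 := by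
  simp [ρ.s_star_s, h]

theorem star_s_mul_p_mul_s_self (hacc : G.Accommodating ℬ) {C : Set V} (hC : C ∈ ℬ) (a : Λ) :
    star (ρ.s a) * ρ.p C * ρ.s a = ρ.p (G.relRange C [a]) := by
  rw [ρ.s_star_p a C hC, mul_assoc, star_s_mul_s_self,
    ρ.p_inter _ (hacc.relRange_mem C hC _ (G.singleton_mem_words a)) _
      (hacc.range_mem _ (G.singleton_mem_words a)),
    Set.inter_eq_left.2 (G.relRange_subset_range C [a])]

theorem star_s_mul_p_mul_s_of_ne {C : Set V} (hC : C ∈ ℬ) {a b : Λ} (h : a ≠ b) :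
    star (ρ.s a) * ρ.p C * ρ.s b = 0 := by
  rw [ρ.s_star_p a C hC, mul_assoc, star_s_mul_s_of_ne ρ h, mul_zero]

theorem star_s_mul_p_of_subset_sinks {A : Set V} (hA : A ∈ ℬ) (hs : A ⊆ G.sinks) (a : Λ) :
    star (ρ.s a) * ρ.p A = 0 := by
  rw [ρ.s_star_p a A hA, G.relRange_singleton_of_subset_sinks hs, ρ.p_empty, zero_mul]

theorem p_mul_s_of_subset_sinks {A : Set V} (hA : A ∈ ℬ) (hs : A ⊆ G.sinks) (a : Λ) :
    ρ.p A * ρ.s a = 0 := by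
  have h := congrArg star (ρ.star_s_mul_p_of_subset_sinks hA hs a)
  simpa [ρ.p_selfAdjoint A hA] using h

theorem star_sWord_mul_p_mul_sWord_self (hacc : G.Accommodating ℬ) (w : List Λ) :
    ∀ {C : Set V}, C ∈ ℬ → ∀ a : Λ,
      star (ρ.sWord (a :: w)) * ρ.p C * ρ.sWord (a :: w) = ρ.p (G.relRange C (a :: w)) := by
  induction w with
  | nil =>
    intro C hC a
    simpa using ρ.star_s_mul_p_mul_s_self hacc hC a
  | cons b w ih =>
    intro C hC a
    rw [G.relRange_cons_cons, ← ih (hacc.relRange_mem C hC _ (G.singleton_mem_words a)) b,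
      ← ρ.star_s_mul_p_mul_s_self hacc hC a, sWord_cons ρ a, star_mul]
    simp only [mul_assoc]

theorem star_sWord_mul_sWord_self (hacc : G.Accommodating ℬ) (a : Λ) (w : List Λ) :
    star (ρ.sWord (a :: w)) * ρ.sWord (a :: w) = ρ.p (G.range (a :: w)) := by
  have key : star (ρ.sWord (a :: w)) * ρ.sWord (a :: w) =
      star (ρ.sWord w) * ρ.p (G.range [a]) * ρ.sWord w := by
    rw [← star_s_mul_s_self, sWord_cons, star_mul]
    simp only [mul_assoc]
  rw [key]
  cases w with
  | nil => simp
  | cons b w =>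
    rw [ρ.star_sWord_mul_p_mul_sWord_self hacc w (hacc.range_mem _ (G.singleton_mem_words a)) b]
    simp only [LabeledGraph.range, G.relRange_cons_cons]

theorem p_mul_star_sWord_mul_p_mul_sWord_mul_p_of_ne (hacc : G.Accommodating ℬ) {A : Set V}
    (hA : A ∈ ℬ) (hs : A ⊆ G.sinks) (β : List Λ) :
    ∀ (μ : List Λ) {C : Set V}, C ∈ ℬ → β ≠ μ →
      ρ.p A * (star (ρ.sWord β) * ρ.p C * ρ.sWord μ) * ρ.p A = 0 := by
  induction β with
  | nil =>
    intro μ C hC h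
    cases μ with
    | nil => exact absurd rfl h
    | cons a μ =>
      have h0 := ρ.p_mul_s_of_subset_sinks (hacc.inter_mem A hA C hC)
        (Set.inter_subset_left.trans hs) a
      rw [← ρ.p_inter A hA C hC] at h0
      simp only [sWord_nil, star_one, one_mul, sWord_cons]
      rw [← mul_assoc (ρ.p C), ← mul_assoc (ρ.p A), ← mul_assoc (ρ.p A), h0, zero_mul, zero_mul]
  | cons b β ih =>
    intro μ C hC h
    cases μ with
    | nil =>
      have h0 := ρ.star_s_mul_p_of_subset_sinks (hacc.inter_mem C hC A hA)
        (Set.inter_subset_right.trans hs) b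
      rw [← ρ.p_inter C hC A hA] at h0
      simp only [sWord_nil, mul_one, sWord_cons, star_mul, mul_assoc]
      rw [h0, mul_zero, mul_zero]
    | cons a μ =>
      have e : star (ρ.sWord (b :: β)) * ρ.p C * ρ.sWord (a :: μ) =
          star (ρ.sWord β) * (star (ρ.s b) * ρ.p C * ρ.s a) * ρ.sWord μ := by
        simp only [sWord_cons, star_mul, mul_assoc]
      rw [e]
      by_cases hab : b = a
      · subst hab
        rw [ρ.star_s_mul_p_mul_s_self hacc hC]
        exact ih μ (hacc.relRange_mem C hC _ (G.singleton_mem_words b)) (by simpa using h)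
      · rw [ρ.star_s_mul_p_mul_s_of_ne hC hab]
        simp

theorem p_mul_star_sWord_mul_sWord_mul_p_of_ne (hacc : G.Accommodating ℬ) {A : Set V}
    (hA : A ∈ ℬ) (hs : A ⊆ G.sinks) {β μ : List Λ} (h : β ≠ μ) :
    ρ.p A * (star (ρ.sWord β) * ρ.sWord μ) * ρ.p A = 0 := by
  match β, μ with
  | [], [] => exact absurd rfl h
  | [], a :: μ =>
    simp only [sWord_nil, star_one, one_mul, sWord_cons]
    rw [← mul_assoc, ρ.p_mul_s_of_subset_sinks hA hs, zero_mul, zero_mul]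
  | b :: β, [] =>
    simp only [sWord_nil, mul_one, sWord_cons, star_mul, mul_assoc]
    rw [ρ.star_s_mul_p_of_subset_sinks hA hs, mul_zero, mul_zero]
  | b :: β, a :: μ =>
    have e : star (ρ.sWord (b :: β)) * ρ.sWord (a :: μ) =
        star (ρ.sWord β) * (star (ρ.s b) * ρ.s a) * ρ.sWord μ := by
      simp only [sWord_cons, star_mul, mul_assoc]
    rw [e]
    by_cases hab : b = a
    · subst hab
      rw [star_s_mul_s_self]
      exact ρ.p_mul_star_sWord_mul_p_mul_sWord_mul_p_of_ne hacc hA hs β μ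
        (hacc.range_mem _ (G.singleton_mem_words b)) (by simpa using h)
    · rw [ρ.star_s_mul_s_of_ne hab]
      simp

theorem p_mul_star_sWord_mul_sWord_mul_p_self (hacc : G.Accommodating ℬ) {A : Set V}
    (hA : A ∈ ℬ) {β : List Λ} (hβ : β = [] ∨ β ∈ G.words ∧ A ⊆ G.range β) :
    ρ.p A * (star (ρ.sWord β) * ρ.sWord β) * ρ.p A = ρ.p A := by
  have hAA : ρ.p A * ρ.p A = ρ.p A := by rw [ρ.p_inter A hA A hA, Set.inter_self]
  cases β with
  | nil => simpa using hAA
  | cons b β =>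
    obtain ⟨hw, hsub⟩ := hβ.resolve_left (by simp)
    rw [ρ.star_sWord_mul_sWord_self hacc, ρ.p_inter A hA _ (hacc.range_mem _ hw),
      Set.inter_eq_left.2 hsub, hAA]

end LabeledSpaceRep

theorem stmt15 {V : Type u} {E : Type v} {Λ : Type w}
    (G : LabeledGraph V E Λ) (ℬ : Set (Set V))
    (hacc : G.Accommodating ℬ) (hwlr : G.WeaklyLeftResolving ℬ)
    {B : Type*} [CStarAlgebra B] (ρ : LabeledSpaceRep G ℬ B)
    (A : Set V) (hA : G.MinimalSinksSet ℬ A)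
    (LA : Set (List Λ)) (hLA : LA = insert [] {α | α ∈ G.words ∧ A ⊆ G.range α}) :
    ∀ α ∈ LA, ∀ β ∈ LA, ∀ μ ∈ LA, ∀ ν ∈ LA,
      (ρ.sWord α * ρ.p A * star (ρ.sWord β)) * (ρ.sWord μ * ρ.p A * star (ρ.sWord ν)) =
        (open Classical in
          if β = μ then ρ.sWord α * ρ.p A * star (ρ.sWord ν) else 0) ∧
      star (ρ.sWord α * ρ.p A * star (ρ.sWord β)) = ρ.sWord β * ρ.p A * star (ρ.sWord α) := by
  subst hLA
  obtain ⟨hAB, -, hs, -⟩ := hA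
  intro α _ β hβ μ _ ν _
  constructor
  · have e : (ρ.sWord α * ρ.p A * star (ρ.sWord β)) * (ρ.sWord μ * ρ.p A * star (ρ.sWord ν)) =
        ρ.sWord α * (ρ.p A * (star (ρ.sWord β) * ρ.sWord μ) * ρ.p A) * star (ρ.sWord ν) := by
      simp only [mul_assoc]
    rw [e]
    split_ifs with h
    · subst h
      rw [ρ.p_mul_star_sWord_mul_sWord_mul_p_self hacc hAB hβ]
    · rw [ρ.p_mul_star_sWord_mul_sWord_mul_p_of_ne hacc hAB hs h]
      simp
  · rw [star_mul, star_mul, star_star, ρ.p_selfAdjoint A hAB, mul_assoc]
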